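/- Let c ≥ 1 be an integer and let (f_n)_{n∈ℕ} be a family of Boolean functions f_n : {0,1}^n × {0,1}^n → {0,1}. If there is a polynomial p with GH_{ε(n)}(f_n) ≤ p(n) for all n, where ε(n) = 1/2 − n^{−c}, then there is a polynomial q with GH(f_n) ≤ q(n) for all n: randomized garden-hose protocols can be derandomized with polynomial overhead. -/

import Mathlib

/-- A partial matching on the vertex type `V`, encoded by a partner function:
`m i = some j` means that there is an edge between `i` and `j`;
the graph `{ {i,j} | m i = some j }` then has maximum degree at most `1`
and no self-loops. -/
def IsPartialMatching {V : Type*} (m : V → Option V) : Prop :=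
  ∀ i j, m i = some j → i ≠ j ∧ m j = some i

/-- The position of the water in a garden-hose game with `s` pipes:
`atAlice i` (resp. `atBob i`) means the water has just arrived at Alice's
(resp. Bob's) end of pipe `i`; `exitA` / `exitB` mean the water has exited
on Alice's / Bob's side, i.e. the maximal path starting at the tap has ended
in `A∘` / in `B`. -/
inductive GHState (s : ℕ) where
  | atAlice : Fin s → GHState s
  | atBob : Fin s → GHState s
  | exitA : GHState s
  | exitB : GHState s
  deriving DecidableEq

/-- Vertex `k` of `A∘ = {0, 1, ..., s}` viewed as a pipe: vertex `0` is the water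
tap (no pipe), and vertex `i + 1` is Alice's end of pipe `i`. -/
def toPipe {s : ℕ} (k : Fin (s + 1)) : Option (Fin s) :=
  if h : (k : ℕ) = 0 then none
  else some ⟨(k : ℕ) - 1, by have := k.isLt; omega⟩

/-- One step of the water flow, given Alice's connections `a` on `A∘ = {0,...,s}`
and Bob's connections `b` on `B = {1,...,s}` (indexed by pipes `Fin s`). -/
def ghStep {s : ℕ} (a : Fin (s + 1) → Option (Fin (s + 1)))
    (b : Fin s → Option (Fin s)) : GHState s → GHState s
  | GHState.atAlice i =>
    match a i.succ with
    | none => GHState.exitA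
    | some k =>
      match toPipe k with
      | none => GHState.exitA
      | some p => GHState.atBob p
  | GHState.atBob i =>
    match b i with
    | none => GHState.exitB
    | some j => GHState.atAlice j
  | GHState.exitA => GHState.exitA
  | GHState.exitB => GHState.exitB

/-- The start of the water flow: the tap (vertex `0` of `A∘`) is connected by
Alice to at most one pipe. -/
def ghStart {s : ℕ} (a : Fin (s + 1) → Option (Fin (s + 1))) : GHState s :=
  match a 0 with
  | none => GHState.exitA
  | some k =>
    match toPipe k with
    | none => GHState.exitA
    | some p => GHState.atBob p

/-- The endpoint of the maximal path `π(x,y)` starting at the tap: since the graph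
has maximum degree `2` and the path is simple, it is reached after at most
`2s + 2` steps. -/
def ghResult {s : ℕ} (a : Fin (s + 1) → Option (Fin (s + 1)))
    (b : Fin s → Option (Fin s)) : GHState s :=
  (ghStep a b)^[2 * s + 2] (ghStart a)

/-- A garden-hose game of size `s` on inputs `{0,1}^n × {0,1}^n`: for every input
`x` Alice chooses a partial matching `EA x` on `A∘ = {0,1,…,s}` and for every
input `y` Bob chooses a partial matching `EB y` on `B = {1,…,s}`. -/
structure GHGame (n s : ℕ) where
  EA : (Fin n → Bool) → Fin (s + 1) → Option (Fin (s + 1))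
  EB : (Fin n → Bool) → Fin s → Option (Fin s)
  matchA : ∀ x, IsPartialMatching (EA x)
  matchB : ∀ y, IsPartialMatching (EB y)

/-- Where the water exits on input `(x, y)`. -/
def GHGame.run {n s : ℕ} (G : GHGame n s) (x y : Fin n → Bool) : GHState s :=
  ghResult (G.EA x) (G.EB y)

/-- The game `G` computes `f` if for all inputs the maximal path from the tap ends
in `A∘` whenever `f x y = 0` (water exits on Alice's side) and in `B` whenever
`f x y = 1` (water exits on Bob's side). -/
def GHGame.Computes {n s : ℕ} (G : GHGame n s)
    (f : (Fin n → Bool) → (Fin n → Bool) → Bool) : Prop :=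
  ∀ x y, G.run x y = if f x y then GHState.exitB else GHState.exitA

/-- The garden-hose complexity of `f`: the minimal number of pipes of a
garden-hose game computing `f`. -/
noncomputable def GH {n : ℕ} (f : (Fin n → Bool) → (Fin n → Bool) → Bool) : ℕ :=
  sInf {s : ℕ | ∃ G : GHGame n s, G.Computes f}
/-- A randomized garden-hose protocol of size `s` for `f` with error `ε`:
a finite set (indexed by `Fin k`) equipped with a probability distribution
`prob` and, for each random string `r`, a garden-hose game `game r` of size `s`
such that for every input `(x, y)` the probability over `r` that `game r`
computes the value `f x y` at `(x, y)` is at least `1 - ε`. -/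
structure RandGHProtocol (n s : ℕ) (f : (Fin n → Bool) → (Fin n → Bool) → Bool)
    (ε : ℝ) where
  k : ℕ
  prob : Fin k → ℝ
  prob_nonneg : ∀ r, 0 ≤ prob r
  prob_sum : ∑ r, prob r = 1
  game : Fin k → GHGame n s
  correct : ∀ x y, 1 - ε ≤ ∑ r,
    if (game r).run x y = (if f x y then GHState.exitB else GHState.exitA)
    then prob r else 0

/-- The randomized garden-hose complexity `GH_ε(f)`: the minimal size of a
randomized garden-hose protocol for `f` with error `ε`. -/
noncomputable def GHr {n : ℕ} (ε : ℝ)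
    (f : (Fin n → Bool) → (Fin n → Bool) → Bool) : ℕ :=
  sInf {s : ℕ | Nonempty (RandGHProtocol n s f ε)}

namespace GHProof

lemma rtg_lift {α β : Type*} {r : α → α → Prop} {p : β → β → Prop} (f : α → β)
    (h : ∀ a b, r a b → p (f a) (f b)) {a b : α} (hab : Relation.ReflTransGen r a b) :
    Relation.ReflTransGen p (f a) (f b) := by
  induction hab with
  | refl => exact Relation.ReflTransGen.refl
  | tail _ h2 ih => exact ih.tail (h _ _ h2)

section basic
variable {V : Type*}

def stp (a b : V → Option V) : Bool × V → Option (Bool × V)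
  | (true, v) => (a v).map (fun w => (false, w))
  | (false, v) => (b v).map (fun w => (true, w))

def R (a b : V → Option V) (S T : Bool × V) : Prop := stp a b S = some T

abbrev Reach (a b : V → Option V) := Relation.ReflTransGen (R a b)

def Out (a b : V → Option V) (v0 : V) (t : Bool) : Prop :=
  ∃ v, Reach a b (true, v0) (t, v) ∧ stp a b (t, v) = none ∧ (t, v) ≠ (false, v0)

def rev (S : Bool × V) : Bool × V := (!S.1, S.2)

lemma rev_rev (S : Bool × V) : rev (rev S) = S := by
  rcases S with ⟨t, v⟩; simp [rev]

lemma R_true {a b : V → Option V} {v : V} {T} : R a b (true, v) T ↔ ∃ w, a v = some w ∧ T = (false, w) := by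
  simp only [R, stp, Option.map_eq_some_iff]
  constructor <;> rintro ⟨w, h, h'⟩ <;> exact ⟨w, h, h'.symm⟩

lemma R_false {a b : V → Option V} {v : V} {T} : R a b (false, v) T ↔ ∃ w, b v = some w ∧ T = (true, w) := by
  simp only [R, stp, Option.map_eq_some_iff]
  constructor <;> rintro ⟨w, h, h'⟩ <;> exact ⟨w, h, h'.symm⟩

lemma R_rev {a b : V → Option V} (ha : IsPartialMatching a) (hb : IsPartialMatching b)
    {S T} (h : R a b S T) : R a b (rev T) (rev S) := by
  rcases S with ⟨_ | _, v⟩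
  · obtain ⟨w, hw, rfl⟩ := R_false.1 h
    exact R_false.2 ⟨v, (hb _ _ hw).2, rfl⟩
  · obtain ⟨w, hw, rfl⟩ := R_true.1 h
    exact R_true.2 ⟨v, (ha _ _ hw).2, rfl⟩

lemma R_det {a b : V → Option V} {S T T'} (h : R a b S T) (h' : R a b S T') : T = T' := by
  unfold R at h h'; rw [h] at h'; exact Option.some.inj h'

lemma R_inj {a b : V → Option V} (ha : IsPartialMatching a) (hb : IsPartialMatching b)
    {S S' T} (h : R a b S T) (h' : R a b S' T) : S = S' := by
  have := R_det (R_rev ha hb h) (R_rev ha hb h')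
  rw [← rev_rev S, this, rev_rev]

lemma R_not_rev {a b : V → Option V} (ha : IsPartialMatching a) (hb : IsPartialMatching b)
    {S} : ¬ R a b S (rev S) := by
  intro h
  rcases S with ⟨_ | _, v⟩
  · obtain ⟨w, hw, h⟩ := R_false.1 h
    simp [rev] at h; subst h; exact (hb _ _ hw).1 rfl
  · obtain ⟨w, hw, h⟩ := R_true.1 h
    simp [rev] at h; subst h; exact (ha _ _ hw).1 rfl

def pw (a b : V → Option V) : ℕ → Bool × V → Bool × V → Prop
  | 0, S, T => S = T
  | n+1, S, T => ∃ U, R a b S U ∧ pw a b n U T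

lemma pw_tail {a b : V → Option V} (n : ℕ) : ∀ S T, pw a b (n+1) S T → ∃ U, pw a b n S U ∧ R a b U T := by
  induction n with
  | zero => rintro S T ⟨U, h, rfl⟩; exact ⟨S, rfl, h⟩
  | succ n ih =>
    rintro S T ⟨U, h, h'⟩
    obtain ⟨W, h1, h2⟩ := ih _ _ h'
    exact ⟨W, ⟨U, h, h1⟩, h2⟩

lemma pw_of_reach {a b : V → Option V} {S T} (h : Reach a b S T) : ∃ n, pw a b n S T := by
  induction h using Relation.ReflTransGen.head_induction_on with
  | refl => exact ⟨0, rfl⟩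
  | head h _ ih => obtain ⟨n, hn⟩ := ih; exact ⟨n+1, _, h, hn⟩

lemma no_pal {a b : V → Option V} (ha : IsPartialMatching a) (hb : IsPartialMatching b)
    (n : ℕ) : ∀ S, ¬ pw a b n S (rev S) := by
  induction n using Nat.strong_induction_on with
  | _ n ih =>
    intro S h
    match n, h with
    | 0, h => rcases S with ⟨t, v⟩; simp [pw, rev] at h
    | 1, h => obtain ⟨U, h, rfl⟩ := h; exact R_not_rev ha hb h
    | n+2, h =>
      obtain ⟨U, h1, h2⟩ := h
      obtain ⟨W, h3, h4⟩ := pw_tail _ _ _ h2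
      have h5 := R_rev ha hb h4
      rw [rev_rev] at h5
      have h6 := R_det h1 h5
      have h7 : W = rev U := by rw [h6, rev_rev]
      subst h7
      exact ih n (by omega) _ h3

lemma out_exists [Finite V] {a b : V → Option V} (ha : IsPartialMatching a)
    (hb : IsPartialMatching b) {v0 : V} (h0 : b v0 = none) : ∃ t, Out a b v0 t := by
  by_contra hcon
  have hnt : ∀ S : {S // Reach a b (true, v0) S}, ∃ T : {S // Reach a b (true, v0) S}, R a b S.1 T.1 := by
    rintro ⟨S, hS⟩
    rcases hT : stp a b S with _ | T
    · exfalso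
      apply hcon
      refine ⟨S.1, S.2, hS, hT, ?_⟩
      intro he
      obtain ⟨n, hn⟩ := pw_of_reach hS
      have : S = rev (true, v0) := he
      rw [this] at hn
      exact no_pal ha hb n _ hn
    · exact ⟨⟨T, hS.tail hT⟩, hT⟩
  choose f hf using hnt
  have hinj : Function.Injective f := by
    intro S T h
    have h1 := hf S
    rw [h] at h1
    exact Subtype.ext (R_inj ha hb h1 (hf T))
  obtain ⟨⟨S, hS⟩, hs⟩ := Finite.injective_iff_surjective.1 hinj ⟨(true, v0), Relation.ReflTransGen.refl⟩
  have h := hf ⟨S, hS⟩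
  rw [hs] at h
  rcases S with ⟨_ | _, v⟩
  · obtain ⟨w, hw, h⟩ := R_false.1 h
    simp at h; subst h
    have := (hb _ _ hw).2
    rw [h0] at this; cases this
  · obtain ⟨w, hw, h⟩ := R_true.1 h
    simp at h

end basic

section iter

lemma iter_fixed {α : Type*} [Fintype α] (g : α → α) (x e : α) (he : g e = e)
    (N : ℕ) (hN : g^[N] x = e) (M : ℕ) (hM : Fintype.card α ≤ M + 1) : g^[M] x = e := by
  classical
  have hfix : ∀ j, g^[j] e = e := fun j => Function.iterate_fixed he j
  have hex : ∃ N, g^[N] x = e := ⟨N, hN⟩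
  let K := Nat.find hex
  have hK : g^[K] x = e := Nat.find_spec hex
  have hmin : ∀ j < K, g^[j] x ≠ e := fun j hj => Nat.find_min hex hj
  have hinj : Function.Injective (fun i : Fin (K+1) => g^[(i:ℕ)] x) := by
    have key : ∀ i j : ℕ, i < j → j ≤ K → g^[i] x ≠ g^[j] x := by
      intro i j hij hj h
      have : g^[(K - j) + i] x = e := by
        rw [Function.iterate_add_apply, h, ← Function.iterate_add_apply, Nat.sub_add_cancel hj, hK]
      exact hmin _ (by omega) this
    intro i j h
    rcases lt_trichotomy (i:ℕ) j with hl | hl | hl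
    · exact absurd h (key _ _ hl (by omega))
    · exact Fin.ext hl
    · exact absurd h.symm (key _ _ hl (by omega))
  have hc := Fintype.card_le_of_injective _ hinj
  simp at hc
  obtain ⟨d, rfl⟩ : ∃ d, M = d + K := ⟨M - K, by omega⟩
  rw [Function.iterate_add_apply, hK, hfix]

def stEquiv (s : ℕ) : GHState s ≃ (Fin s ⊕ Fin s) ⊕ Bool where
  toFun
    | .atAlice i => .inl (.inl i)
    | .atBob i => .inl (.inr i)
    | .exitA => .inr true
    | .exitB => .inr false
  invFun
    | .inl (.inl i) => .atAlice i
    | .inl (.inr i) => .atBob i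
    | .inr true => .exitA
    | .inr false => .exitB
  left_inv := by rintro (_ | _ | _ | _) <;> rfl
  right_inv := by rintro ((_ | _) | (_ | _)) <;> rfl

noncomputable instance (s : ℕ) : Fintype (GHState s) := Fintype.ofEquiv _ (stEquiv s).symm

lemma card_st (s : ℕ) : Fintype.card (GHState s) = 2 * s + 2 := by
  rw [Fintype.card_congr (stEquiv s)]; simp; omega

lemma toPipe_zero {s : ℕ} : toPipe (0 : Fin (s+1)) = none := by simp [toPipe]
lemma toPipe_succ {s : ℕ} (i : Fin s) : toPipe i.succ = some i := by simp [toPipe]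

def bl {s : ℕ} (b : Fin s → Option (Fin s)) : Fin (s+1) → Option (Fin (s+1)) :=
  Fin.cases none (fun i => (b i).map Fin.succ)

lemma bl_zero {s : ℕ} (b : Fin s → Option (Fin s)) : bl b 0 = none := rfl
lemma bl_succ {s : ℕ} (b : Fin s → Option (Fin s)) (i) : bl b i.succ = (b i).map Fin.succ := rfl

lemma bl_matching {s : ℕ} {b : Fin s → Option (Fin s)} (hb : IsPartialMatching b) :
    IsPartialMatching (bl b) := by
  intro i j h
  induction i using Fin.cases with
  | zero => simp [bl_zero] at h
  | succ i =>
    rw [bl_succ, Option.map_eq_some_iff] at h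
    obtain ⟨k, hk, rfl⟩ := h
    have := hb _ _ hk
    simp [bl_succ, this.1, this.2]

def phi {s : ℕ} : Bool × Fin (s+1) → GHState s
  | (true, v) => match toPipe v with
    | none => .exitA
    | some p => .atAlice p
  | (false, v) => match toPipe v with
    | none => .exitA
    | some p => .atBob p

lemma result_of_out {s : ℕ} {a : Fin (s+1) → Option (Fin (s+1))} {b : Fin s → Option (Fin s)}
    {t : Bool} (h : Out a (bl b) 0 t) :
    ghResult a b = if t then GHState.exitA else GHState.exitB := by
  obtain ⟨v, hr, ht, hne⟩ := h
  have key : ∀ S, Reach a (bl b) (true, 0) S → S = (true, 0) ∨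
      (S ≠ (true, 0) ∧ ∃ N, (ghStep a b)^[N] (ghStart a) = phi S) := by
    intro S hS
    induction hS with
    | refl => left; rfl
    | @tail S T _ hST ih =>
      right
      rcases S with ⟨_ | _, v⟩
      · obtain ⟨w, hw, rfl⟩ := R_false.1 hST
        induction v using Fin.cases with
        | zero => simp [bl_zero] at hw
        | succ i =>
          rw [bl_succ, Option.map_eq_some_iff] at hw
          obtain ⟨k, hk, rfl⟩ := hw
          refine ⟨by simp [Fin.succ_ne_zero], ?_⟩
          rcases ih with ih | ⟨_, N, hN⟩
          · simp at ih
          · refine ⟨N+1, ?_⟩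
            rw [Function.iterate_succ_apply', hN]
            simp [phi, toPipe_succ, ghStep, hk]
      · obtain ⟨w, hw, rfl⟩ := R_true.1 hST
        refine ⟨by simp, ?_⟩
        induction v using Fin.cases with
        | zero => exact ⟨0, by simp [ghStart, hw, phi]⟩
        | succ i =>
          rcases ih with ih | ⟨_, N, hN⟩
          · simp [Fin.succ_ne_zero] at ih
          · refine ⟨N+1, ?_⟩
            rw [Function.iterate_succ_apply', hN]
            simp [phi, toPipe_succ, ghStep, hw]
  have fin : ∃ N, (ghStep a b)^[N] (ghStart a) = if t then GHState.exitA else GHState.exitB := by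
    induction v using Fin.cases with
    | zero =>
      rcases t with _ | _
      · exact absurd rfl hne
      · have h0 : a 0 = none := by simpa [stp] using ht
        exact ⟨0, by simp [ghStart, h0]⟩
    | succ i =>
      rcases key _ hr with h | ⟨_, N, hN⟩
      · simp [Fin.succ_ne_zero] at h
      · refine ⟨N+1, ?_⟩
        rw [Function.iterate_succ_apply', hN]
        rcases t with _ | _
        · have h0 : b i = none := by simpa [stp, bl_succ] using ht
          simp [phi, toPipe_succ, ghStep, h0]
        · have h0 : a i.succ = none := by simpa [stp] using ht
          simp [phi, toPipe_succ, ghStep, h0]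
  obtain ⟨N, hN⟩ := fin
  refine iter_fixed _ _ _ ?_ N hN _ (by rw [card_st]; omega)
  cases t <;> rfl

end iter

section transfer

lemma game_of_form {n S : ℕ} {V : Type*} [Fintype V] (v0 : V) (hcard : Fintype.card V = S + 1)
    (al be : (Fin n → Bool) → V → Option V) (ha : ∀ x, IsPartialMatching (al x))
    (hb : ∀ y, IsPartialMatching (be y)) (h0 : ∀ y, be y v0 = none) :
    ∃ G : GHGame n S, ∀ x y t, Out (al x) (be y) v0 t →
      G.run x y = if t then GHState.exitA else GHState.exitB := by
  classical
  obtain ⟨e, he⟩ : ∃ e : V ≃ Fin (S+1), e v0 = 0 := by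
    let e0 : V ≃ Fin (S+1) := Fintype.equivFinOfCardEq hcard
    exact ⟨e0.trans (Equiv.swap (e0 v0) 0), by simp⟩
  let EA : (Fin n → Bool) → Fin (S + 1) → Option (Fin (S + 1)) :=
    fun x w => (al x (e.symm w)).map e
  let EB' : (Fin n → Bool) → Fin (S + 1) → Option (Fin (S + 1)) :=
    fun x w => (be x (e.symm w)).map e
  let EB : (Fin n → Bool) → Fin S → Option (Fin S) :=
    fun y i => (EB' y i.succ).bind toPipe
  have hA : ∀ x, IsPartialMatching (EA x) := by
    intro x i j h
    simp only [EA, Option.map_eq_some_iff] at h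
    obtain ⟨w, hw, rfl⟩ := h
    have := ha x _ _ hw
    refine ⟨fun h => this.1 (by rw [h]; simp), by simp [EA, this.2]⟩
  have hB' : ∀ x, IsPartialMatching (EB' x) := by
    intro x i j h
    simp only [EB', Option.map_eq_some_iff] at h
    obtain ⟨w, hw, rfl⟩ := h
    have := hb x _ _ hw
    refine ⟨fun h => this.1 (by rw [h]; simp), by simp [EB', this.2]⟩
  have hB0 : ∀ y, EB' y 0 = none := by
    intro y
    have : e.symm 0 = v0 := by rw [← he]; simp
    simp [EB', this, h0]
  have hbl : ∀ y, bl (EB y) = EB' y := by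
    intro y; funext i
    induction i using Fin.cases with
    | zero => rw [bl_zero, hB0]
    | succ i =>
      rw [bl_succ]
      simp only [EB]
      rcases h : EB' y i.succ with _ | j
      · rfl
      · induction j using Fin.cases with
        | zero =>
          have := (hB' y _ _ h).2
          rw [hB0] at this; cases this
        | succ j => simp [toPipe_succ]
  have hB : ∀ y, IsPartialMatching (EB y) := by
    intro y i j h
    have h1 : EB' y i.succ = some j.succ := by
      rw [← hbl, bl_succ, h]; rfl
    have h2 := hB' y _ _ h1
    refine ⟨fun h => h2.1 (by rw [h]), ?_⟩
    simp [EB, h2.2, toPipe_succ]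
  refine ⟨⟨EA, EB, hA, hB⟩, ?_⟩
  rintro x y t ⟨v, hr, ht, hne⟩
  apply result_of_out
  rw [hbl]
  refine ⟨e v, ?_, ?_, ?_⟩
  · have := rtg_lift (r := R (al x) (be y)) (p := R (EA x) (EB' y))
      (fun S : Bool × V => (S.1, e S.2)) (a := (true, v0)) (b := (t, v)) ?_ hr
    · simpa [he] using this
    · rintro ⟨_ | _, u⟩ T hT
      · obtain ⟨w, hw, rfl⟩ := R_false.1 hT
        exact R_false.2 ⟨e w, by simp [EB', hw], rfl⟩
      · obtain ⟨w, hw, rfl⟩ := R_true.1 hT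
        exact R_true.2 ⟨e w, by simp [EA, hw], rfl⟩
  · cases t
    · have : be y v = none := by simpa [stp] using ht
      simp [stp, EB', this]
    · have : al x v = none := by simpa [stp] using ht
      simp [stp, EA, this]
  · intro h
    apply hne
    simp only [Prod.mk.injEq] at h ⊢
    refine ⟨h.1, e.injective (by rw [he]; exact h.2)⟩

/-- Every function has a game. -/
lemma exists_game {n : ℕ} (f : (Fin n → Bool) → (Fin n → Bool) → Bool) :
    ∃ s, ∃ G : GHGame n s, G.Computes f := by
  classical
  let V := Option ((Fin n → Bool) × Bool)
  let al : (Fin n → Bool) → V → Option V := fun x v =>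
    match v with
    | none => some (some (x, false))
    | some (x', false) => if x' = x then some none else none
    | some (_, true) => none
  let be : (Fin n → Bool) → V → Option V := fun y v =>
    match v with
    | none => none
    | some (x', t) => if f x' y then none else some (some (x', !t))
  have hal : ∀ x, IsPartialMatching (al x) := by
    intro x i j h
    rcases i with _ | ⟨x', _ | _⟩
    · simp [al] at h; subst h; simp [al]
    · simp [al] at h; obtain ⟨rfl, rfl⟩ := h; simp [al]
    · simp [al] at h
  have hbe : ∀ y, IsPartialMatching (be y) := by
    intro y i j h
    rcases i with _ | ⟨x', t⟩
    · simp [be] at h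
    · simp [be] at h
      obtain ⟨h, rfl⟩ := h
      simp [be, h]
      intro h'
      have h2 := congrArg Prod.snd (Option.some.inj h')
      cases t <;> simp at h2
  obtain ⟨G, hG⟩ := game_of_form (n := n) (S := Fintype.card ((Fin n → Bool) × Bool)) (V := V) none
    (by simp [V]) al be hal hbe (fun _ => rfl)
  · refine ⟨_, G, fun x y => ?_⟩
    rw [hG x y (!f x y)]
    · cases f x y <;> rfl
    have h1 : Reach (al x) (be y) (true, none) (false, some (x, false)) :=
      Relation.ReflTransGen.single (R_true.2 ⟨_, rfl, rfl⟩)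
    cases hf : f x y
    · refine ⟨some (x, true), h1.tail (R_false.2 ⟨some (x, true), ?_, rfl⟩), ?_, by simp⟩
      · simp [be, hf]
      · simp [stp, al]
    · refine ⟨some (x, false), h1, ?_, by simp⟩
      simp [stp, be, hf]

end transfer

section big
variable {m : ℕ} {U : Type*} [DecidableEq U]

abbrev P (m : ℕ) (U : Type*) := ZMod (m+1) × ZMod (m+1) × Bool × U

def bigA (ga : ZMod (m+1) → U → Option U) : P m U → Option (P m U)
  | (i, c, t, u) => if i = -1 then none else
    match ga i u with
    | some w => some (i, c, t, w)
    | none => some (i, c, !t, u)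

def ok (m : ℕ) (i c : ZMod (m+1)) : Prop := i ≠ 0 ∧ ¬ (i = -1 ∧ m < 2 * c.val)

open Classical in
noncomputable def bigB (gb : ZMod (m+1) → U → Option U) (u0 : U) : P m U → Option (P m U)
  | (i, c, t, u) => if u = u0 then
      match t with
      | true => if ok m (i+1) c then some (i+1, c, false, u0) else none
      | false => if ok m i c then some (i-1, c, true, u0) else none
    else
      match gb i u with
      | some w => some (i, c, t, w)
      | none =>
        match t with
        | true => some (i, c-1, false, u)
        | false => some (i, c+1, true, u)

lemma bigA_matching {ga : ZMod (m+1) → U → Option U} (h : ∀ i, IsPartialMatching (ga i)) :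
    IsPartialMatching (bigA ga) := by
  rintro ⟨i, c, t, u⟩ j hj
  by_cases hi : i = -1
  · simp [bigA, hi] at hj
  rcases hg : ga i u with _ | w
  · simp [bigA, hi, hg] at hj
    subst hj
    simp [bigA, hi, hg]
  · simp [bigA, hi, hg] at hj
    subst hj
    have := h _ _ _ hg
    simp [bigA, hi, this]

lemma bigB_matching {gb : ZMod (m+1) → U → Option U} {u0 : U} (h : ∀ i, IsPartialMatching (gb i))
    (h0 : ∀ i, gb i u0 = none) :
    IsPartialMatching (bigB gb u0) := by
  rintro ⟨i, c, t, u⟩ j hj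
  by_cases hu : u = u0
  · subst hu
    cases t
    · simp [bigB] at hj
      obtain ⟨hk, rfl⟩ := hj
      simp [bigB, hk]
    · simp [bigB] at hj
      obtain ⟨hk, rfl⟩ := hj
      simp [bigB, hk]
  · rcases hg : gb i u with _ | w
    · cases t <;> simp [bigB, hu, hg] at hj <;> subst hj <;> simp [bigB, hu, hg]
    · simp [bigB, hu, hg] at hj
      subst hj
      have := h _ _ _ hg
      have hw : w ≠ u0 := by
        rintro rfl; rw [h0] at this; simp at this
      simp [bigB, hw, this]

lemma layer [Finite U] {ga gb : ZMod (m+1) → U → Option U} {u0 : U}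
    (hA : ∀ i, IsPartialMatching (ga i))
    (hB : ∀ i, IsPartialMatching (gb i)) (h0 : ∀ i, gb i u0 = none)
    (i c : ZMod (m+1)) (hi : i ≠ -1) (t : Bool) (ht : Out (ga i) (gb i) u0 t) :
    Reach (bigA ga) (bigB gb u0) (true, (i, c, false, u0))
      (false, (i, c + (if t then 0 else 1), true, u0)) := by
  obtain ⟨v, hr, ht, hne⟩ := ht
  have hF : ∀ S, Reach (ga i) (gb i) (true, u0) S →
      Reach (bigA ga) (bigB gb u0) (true, (i, c, false, u0)) (S.1, (i, c, false, S.2)) := by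
    intro S hS
    refine rtg_lift (r := R (ga i) (gb i))
      (fun S : Bool × U => (S.1, ((i, c, false, S.2) : P m U))) ?_ hS
    rintro ⟨_ | _, u⟩ T hT
    · obtain ⟨w, hw, rfl⟩ := R_false.1 hT
      have hu : u ≠ u0 := by rintro rfl; rw [h0] at hw; cases hw
      exact R_false.2 ⟨_, by simp [bigB, hw, hu], rfl⟩
    · obtain ⟨w, hw, rfl⟩ := R_true.1 hT
      exact R_true.2 ⟨_, by simp [bigA, hw, hi], rfl⟩
  have hM : ∀ d S, Reach (ga i) (gb i) (true, u0) S →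
      Reach (bigA ga) (bigB gb u0) (!S.1, (i, d, true, S.2)) (false, (i, d, true, u0)) := by
    intro d S hS
    induction hS with
    | refl => exact Relation.ReflTransGen.refl
    | @tail S T _ hT ih =>
      refine Relation.ReflTransGen.head ?_ ih
      rcases S with ⟨_ | _, u⟩
      · obtain ⟨w, hw, rfl⟩ := R_false.1 hT
        have hw2 := (hB _ _ _ hw).2
        have hu : w ≠ u0 := by rintro rfl; rw [h0] at hw2; cases hw2
        exact R_false.2 ⟨_, by simp [bigB, hw2, hu], rfl⟩
      · obtain ⟨w, hw, rfl⟩ := R_true.1 hT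
        have hw2 := (hA _ _ _ hw).2
        exact R_true.2 ⟨_, by simp [bigA, hw2, hi], rfl⟩
  refine ((hF _ hr).tail ?_).trans (hM _ _ hr)
  cases t
  · have hb : gb i v = none := by simpa [stp] using ht
    have hv : v ≠ u0 := by rintro rfl; exact hne rfl
    exact R_false.2 ⟨_, by simp [bigB, hb, hv], rfl⟩
  · have hb : ga i v = none := by simpa [stp] using ht
    exact R_true.2 ⟨_, by simp [bigA, hb, hi], rfl⟩

/-- The number of layers below `i` whose game exits at Bob's side. -/
def cnt (o : ℕ → Bool) (i : ℕ) : ℕ := ∑ j ∈ Finset.range i, if o j then 0 else 1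

lemma cnt_le (o : ℕ → Bool) (i : ℕ) : cnt o i ≤ i := by
  unfold cnt
  calc _ ≤ ∑ j ∈ Finset.range i, 1 := Finset.sum_le_sum (fun j _ => by split <;> simp)
    _ = i := by simp

lemma cast_ne {j : ℕ} (h : j < m) : ((j : ℕ) : ZMod (m+1)) ≠ -1 := by
  intro h2
  have h3 : ((j + 1 : ℕ) : ZMod (m+1)) = 0 := by push_cast; rw [h2]; ring
  rw [ZMod.natCast_eq_zero_iff] at h3
  have := Nat.le_of_dvd (by omega) h3
  omega

lemma big_out [Finite U] {ga gb : ZMod (m+1) → U → Option U} {u0 : U}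
    (hA : ∀ i, IsPartialMatching (ga i))
    (hB : ∀ i, IsPartialMatching (gb i)) (h0 : ∀ i, gb i u0 = none)
    (o : ℕ → Bool) (ho : ∀ j < m, Out (ga j) (gb j) u0 (o j)) :
    Out (bigA ga) (bigB gb u0) ((0, 0, false, u0) : P m U) (!decide (m < 2 * cnt o m)) := by
  have hval : ∀ i ≤ m, ((cnt o i : ℕ) : ZMod (m+1)).val = cnt o i := by
    intro i hi
    apply ZMod.val_cast_of_lt
    have := cnt_le o i; omega
  have hlast : ((m : ℕ) : ZMod (m+1)) = -1 := by
    have : ((m + 1 : ℕ) : ZMod (m+1)) = 0 := ZMod.natCast_self _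
    push_cast at this
    exact eq_neg_of_add_eq_zero_left this
  have hstep : ∀ i < m, Reach (bigA ga) (bigB gb u0) (true, ((i : ℕ), (cnt o i : ℕ), false, u0))
      (false, (((i : ℕ) : ZMod (m+1)), ((cnt o (i+1) : ℕ) : ZMod (m+1)), true, u0)) := by
    intro i hi
    have := layer hA hB h0 (i : ZMod (m+1)) (cnt o i : ℕ) (cast_ne hi) (o i) (ho i hi)
    have he : ((cnt o (i+1) : ℕ) : ZMod (m+1)) = (cnt o i : ℕ) + (if o i then 0 else 1) := by
      simp only [cnt, Finset.sum_range_succ]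
      push_cast
      rfl
    rw [he]; exact this
  have hne0 : ∀ i < m, ((i : ℕ) : ZMod (m+1)) + 1 ≠ 0 := by
    intro i hi h
    exact cast_ne hi (eq_neg_of_add_eq_zero_left h)
  have hmain : ∀ i ≤ m, (i = m → ¬ (m < 2 * cnt o m)) →
      Reach (bigA ga) (bigB gb u0) (true, (0, 0, false, u0))
      (true, (((i : ℕ) : ZMod (m+1)), ((cnt o i : ℕ) : ZMod (m+1)), false, u0)) := by
    intro i
    induction i with
    | zero => intro _ _; simp [cnt]; exact Relation.ReflTransGen.refl
    | succ i ih =>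
      intro hi hacc
      refine ((ih (by omega) (by omega)).trans (hstep i (by omega))).tail ?_
      refine R_false.2 ⟨((((i+1 : ℕ)) : ZMod (m+1)), ((cnt o (i+1) : ℕ) : ZMod (m+1)), false, u0), ?_, rfl⟩
      have hok : ok m ((i : ZMod (m+1)) + 1) ((cnt o (i+1) : ℕ) : ZMod (m+1)) := by
        refine ⟨hne0 i (by omega), ?_⟩
        rintro ⟨h1, h2⟩
        rw [hval _ hi] at h2
        by_cases hm : i + 1 = m
        · apply hacc hm; rw [hm] at h2; exact h2
        · exact cast_ne (m := m) (j := i+1) (by omega) (by push_cast; exact h1)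
      simp [bigB, hok]
  by_cases hacc : m < 2 * cnt o m
  · have hm : 0 < m := by
      have := cnt_le o m; omega
    obtain ⟨k, rfl⟩ : ∃ k, m = k + 1 := ⟨m - 1, by omega⟩
    refine ⟨((k : ZMod (k+1+1)), ((cnt o (k+1) : ℕ) : ZMod (k+1+1)), true, u0), ?_, ?_, ?_⟩
    · simp only [hacc, decide_true, Bool.not_true]
      exact (hmain k (by omega) (by omega)).trans (hstep k (by omega))
    · have hnok : ¬ ok (k+1) ((k : ZMod (k+1+1)) + 1) ((cnt o (k+1) : ℕ) : ZMod (k+1+1)) := by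
        rintro ⟨_, h⟩
        apply h
        refine ⟨?_, ?_⟩
        · rw [← hlast]; push_cast; rfl
        · rw [hval _ le_rfl]; exact hacc
      simp [hacc, stp, bigB, hnok]
    · simp
  · refine ⟨((m : ZMod (m+1)), ((cnt o m : ℕ) : ZMod (m+1)), false, u0), ?_, ?_, ?_⟩
    · simp only [hacc, decide_false, Bool.not_false]
      exact hmain m le_rfl (fun _ => hacc)
    · simp [hacc, stp, bigA, hlast]
    · simp [hacc]

lemma bigB_start {gb : ZMod (m+1) → U → Option U} {u0 : U} :
    bigB gb u0 ((0, 0, false, u0) : P m U) = none := by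
  simp [bigB, ok]

end big

/-- Majority of `m` games of size `s`. -/
lemma majority {n s m : ℕ} (g : Fin m → GHGame n s)
    (f : (Fin n → Bool) → (Fin n → Bool) → Bool)
    (hmaj : ∀ x y, m < 2 * (Finset.univ.filter (fun i => (g i).run x y =
      if f x y then GHState.exitB else GHState.exitA)).card) :
    ∃ G : GHGame n ((m+1)*(m+1)*(2*(s+1)) - 1), G.Computes f := by
  classical
  have hm : 0 < m := by
    by_contra h
    have := hmaj (fun _ => false) (fun _ => false)
    have h2 := Finset.card_le_univ (Finset.univ.filter (fun i => (g i).run (fun _ => false) (fun _ => false) =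
      if f (fun _ => false) (fun _ => false) then GHState.exitB else GHState.exitA))
    simp only [Fintype.card_fin] at h2
    omega
  let idx : ZMod (m+1) → Fin m := fun i => if h : i.val < m then ⟨i.val, h⟩ else ⟨0, hm⟩
  have hidx : ∀ j (h : j < m), idx ((j : ℕ) : ZMod (m+1)) = ⟨j, h⟩ := by
    intro j h
    have : ((j : ℕ) : ZMod (m+1)).val = j := ZMod.val_cast_of_lt (by omega)
    simp [idx, this, h]
  obtain ⟨G, hG⟩ := game_of_form (n := n) (S := (m+1)*(m+1)*(2*(s+1)) - 1) (V := P m (Fin (s+1)))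
    (0, 0, false, 0) (by
      simp [P, ZMod.card]
      rw [Nat.sub_add_cancel]
      · ring
      · exact Nat.succ_le_of_lt (by positivity))
    (fun x => bigA (fun i => (g (idx i)).EA x))
    (fun y => bigB (fun i => bl ((g (idx i)).EB y)) 0)
    (fun x => bigA_matching (fun i => (g (idx i)).matchA x))
    (fun y => bigB_matching (fun i => bl_matching ((g (idx i)).matchB y)) (fun _ => rfl))
    (fun y => bigB_start)
  refine ⟨G, fun x y => ?_⟩
  have hout : ∀ i : Fin m, ∃ t, Out ((g i).EA x) (bl ((g i).EB y)) 0 t := fun i =>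
    out_exists ((g i).matchA x) (bl_matching ((g i).matchB y)) rfl
  choose o ho using hout
  have hrun : ∀ i, (g i).run x y = if o i then GHState.exitA else GHState.exitB :=
    fun i => result_of_out (ho i)
  let o' : ℕ → Bool := fun j => if h : j < m then o ⟨j, h⟩ else true
  have hbig := big_out (m := m) (u0 := (0 : Fin (s+1)))
    (ga := fun i => (g (idx i)).EA x) (gb := fun i => bl ((g (idx i)).EB y))
    (fun i => (g (idx i)).matchA x) (fun i => bl_matching ((g (idx i)).matchB y)) (fun _ => rfl) o'
    (by
      intro j hj
      simp only [hidx j hj, o', hj, dif_pos]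
      exact ho _)
  rw [hG x y _ hbig]
  have hcnt : cnt o' m = (Finset.univ.filter (fun i => o i = false)).card := by
    rw [cnt, Finset.sum_range, Finset.card_filter]
    refine Finset.sum_congr rfl (fun i _ => ?_)
    simp [o']
    cases o i <;> rfl
  have hsplit : (Finset.univ.filter (fun i => o i = false)).card +
      (Finset.univ.filter (fun i => o i = true)).card = m := by
    have := Finset.card_filter_add_card_filter_not (s := (Finset.univ : Finset (Fin m))) (fun i => o i = false)
    simpa using this
  have h := hmaj x y
  simp only [hrun] at h
  rw [hcnt]
  cases hf : f x y
  · rw [hf] at h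
    have : (Finset.univ.filter (fun i => (if o i then GHState.exitA else GHState.exitB : GHState s) =
      if false = true then GHState.exitB else GHState.exitA)) = Finset.univ.filter (fun i => o i = true) := by
      ext i; cases hi : o i <;> simp [hi]
    rw [this] at h
    have : ¬ m < 2 * (Finset.univ.filter (fun i => o i = false)).card := by omega
    simp [this]
  · rw [hf] at h
    have : (Finset.univ.filter (fun i => (if o i then GHState.exitA else GHState.exitB : GHState s) =
      if true = true then GHState.exitB else GHState.exitA)) = Finset.univ.filter (fun i => o i = false) := by
      ext i; cases hi : o i <;> simp [hi]
    rw [this] at h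
    simp [h]

/-- Chernoff plus union bound. -/
lemma sampling {I : Type*} [Fintype I] {k : ℕ} (prob : Fin k → ℝ) (h0 : ∀ r, 0 ≤ prob r)
    (h1 : ∑ r, prob r = 1) (C : I → Fin k → Prop) [∀ i r, Decidable (C i r)] (d : ℝ) (hd0 : 0 < d)
    (hd1 : d ≤ 1/2)
    (hC : ∀ i, 1/2 + d ≤ ∑ r, if C i r then prob r else 0) (m : ℕ)
    (hm : (Fintype.card I : ℝ) * (1 - d^2)^m < 1) :
    ∃ r : Fin m → Fin k, ∀ i, m < 2 * (Finset.univ.filter (fun j => C i (r j))).card := by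
  set z : ℝ := 1 + d with hz
  have hzp : 0 < z := by positivity
  let w : I → Fin k → ℝ := fun i r => if C i r then z⁻¹ else z
  have hw : ∀ i r, 0 < w i r := by
    intro i r; simp only [w]; split <;> positivity
  have hE : ∀ i, ∑ r, prob r * w i r ≤ 1 - d^2 := by
    intro i
    set q := ∑ r, if C i r then prob r else 0 with hq
    have e1 : ∑ r, prob r * w i r = q * z⁻¹ + (1 - q) * z := by
      rw [← h1, hq, ← Finset.sum_sub_distrib, Finset.sum_mul, Finset.sum_mul, ← Finset.sum_add_distrib]
      refine Finset.sum_congr rfl (fun r _ => ?_)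
      simp only [w]; split <;> simp
    rw [e1]
    have hq1 := hC i
    have : (q * z⁻¹ + (1 - q) * z) * z ≤ (1 - d^2) * z := by
      have : (q * z⁻¹ + (1 - q) * z) * z = q + (1-q) * z^2 := by field_simp
      rw [this, hz]
      nlinarith [mul_nonneg (sub_nonneg.2 hq1) (by positivity : 0 ≤ 2*d+d^2), sq_nonneg d]
    exact le_of_mul_le_mul_right this hzp
  have hE0 : ∀ i, 0 ≤ ∑ r, prob r * w i r := fun i =>
    Finset.sum_nonneg (fun r _ => mul_nonneg (h0 r) (hw i r).le)
  have hsum1 : ∑ r : Fin m → Fin k, ∏ j, prob (r j) = 1 := by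
    rw [← Fintype.sum_pow, h1, one_pow]
  have htot : ∑ r : Fin m → Fin k, (∏ j, prob (r j)) * ∑ i, ∏ j, w i (r j) < 1 := by
    calc _ = ∑ i, (∑ r, prob r * w i r)^m := by
          simp_rw [Finset.mul_sum]
          rw [Finset.sum_comm]
          refine Finset.sum_congr rfl (fun i _ => ?_)
          rw [Fintype.sum_pow]
          simp_rw [Finset.prod_mul_distrib]
      _ ≤ ∑ i : I, (1 - d^2)^m := Finset.sum_le_sum (fun i _ => pow_le_pow_left₀ (hE0 i) (hE i) m)
      _ = (Fintype.card I : ℝ) * (1 - d^2)^m := by simp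
      _ < 1 := hm
  have hex : ∃ r : Fin m → Fin k, ∑ i, ∏ j, w i (r j) < 1 := by
    by_contra hcon
    push Not at hcon
    have : ∑ r : Fin m → Fin k, (∏ j, prob (r j)) ≤
        ∑ r : Fin m → Fin k, (∏ j, prob (r j)) * ∑ i, ∏ j, w i (r j) :=
      Finset.sum_le_sum (fun r _ => le_mul_of_one_le_right
        (Finset.prod_nonneg (fun j _ => h0 _)) (hcon r))
    linarith
  obtain ⟨r, hr⟩ := hex
  refine ⟨r, fun i => ?_⟩
  have hi : ∏ j, w i (r j) < 1 := lt_of_le_of_lt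
    (Finset.single_le_sum (f := fun i => ∏ j, w i (r j))
      (fun i _ => Finset.prod_nonneg (fun j _ => (hw i _).le)) (Finset.mem_univ i)) hr
  simp only [w, Finset.prod_ite, Finset.prod_const] at hi
  have hsplit := Finset.card_filter_add_card_filter_not (s := (Finset.univ : Finset (Fin m)))
    (fun j => C i (r j))
  simp only [Finset.card_univ, Fintype.card_fin] at hsplit
  by_contra hcon
  have hle : (Finset.univ.filter (fun j => C i (r j))).card ≤
      (Finset.univ.filter (fun j => ¬ C i (r j))).card := by omega
  have := pow_le_pow_right₀ (by linarith : 1 ≤ z) hle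
  rw [inv_pow, inv_mul_lt_iff₀ (by positivity)] at hi
  linarith

lemma main_n (c n : ℕ) (hc : 1 ≤ c) (hn : 2 ≤ n) (f : (Fin n → Bool) → (Fin n → Bool) → Bool) :
    ∃ s : ℕ, s ≤ (((2*n+1)*n^(2*c)+1)*((2*n+1)*n^(2*c)+1)*
        (2*(GHr ((1 : ℝ) / 2 - (n : ℝ) ^ (-(c : ℤ))) f +1)))
      ∧ ∃ G : GHGame n s, G.Computes f := by
  set d : ℝ := (n : ℝ) ^ (-(c : ℤ)) with hd
  have hn' : (2 : ℝ) ≤ n := by exact_mod_cast hn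
  have hdi : d = ((n : ℝ)^c)⁻¹ := by rw [hd, zpow_neg, zpow_natCast]
  have hd0 : 0 < d := by rw [hdi]; positivity
  have hd1 : d ≤ 1/2 := by
    rw [hdi, one_div]
    apply inv_anti₀ (by norm_num)
    calc (2 : ℝ) ≤ n := hn'
      _ = (n : ℝ)^1 := by simp
      _ ≤ (n : ℝ)^c := pow_le_pow_right₀ (by linarith) hc
  have hne : {s : ℕ | Nonempty (RandGHProtocol n s f (1/2 - d))}.Nonempty := by
    obtain ⟨s, G, hG⟩ := exists_game f
    refine ⟨s, ⟨⟨1, fun _ => 1, fun _ => by norm_num, by simp, fun _ => G, fun x y => ?_⟩⟩⟩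
    have := hG x y
    simp [this]
    linarith
  obtain ⟨⟨k, prob, h0, h1, game, hcor⟩⟩ := Nat.sInf_mem hne
  change Fin k → GHGame n (GHr (1/2 - d) f) at game
  set m := (2*n+1)*n^(2*c) with hm
  obtain ⟨r, hr⟩ := sampling (I := (Fin n → Bool) × (Fin n → Bool)) prob h0 h1
    (fun p r => (game r).run p.1 p.2 = if f p.1 p.2 then GHState.exitB else GHState.exitA)
    d hd0 hd1 (fun p => by
      have := hcor p.1 p.2
      refine le_trans (by linarith) this) m (by
      have e1 : (1 - d^2)^m ≤ Real.exp (-(2*n+1)) := by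
        calc (1 - d^2)^m ≤ (Real.exp (-d^2))^m := by
              apply pow_le_pow_left₀
              · nlinarith
              · have := Real.add_one_le_exp (-d^2); linarith
          _ = Real.exp (-(2*n+1)) := by
              rw [← Real.exp_nat_mul]
              congr 1
              rw [hm, hdi]; push_cast
              have : (n : ℝ) ≠ 0 := by positivity
              field_simp
              ring
      have e2 : (2:ℝ)^(2*n+1) ≤ Real.exp (2*n+1) := by
        have : Real.exp (2*n+1) = (Real.exp 1)^(2*n+1) := by
          rw [← Real.exp_nat_mul]; push_cast; ring_nf
        rw [this]
        apply pow_le_pow_left₀ (by norm_num)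
        have := Real.add_one_le_exp (1:ℝ); linarith
      have e3 : (Fintype.card ((Fin n → Bool) × (Fin n → Bool)) : ℝ) = 2^(2*n) := by
        simp; ring
      rw [e3]
      calc (2:ℝ)^(2*n) * (1 - d^2)^m ≤ 2^(2*n) * Real.exp (-(2*n+1)) := by gcongr
        _ < 1 := by
          rw [Real.exp_neg, ← div_eq_mul_inv, div_lt_one (Real.exp_pos _)]
          refine lt_of_lt_of_le ?_ e2
          exact pow_lt_pow_right₀ (by norm_num) (by omega))
  obtain ⟨G, hG⟩ := majority (fun j => game (r j)) f (fun x y => hr (x, y))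
  exact ⟨_, Nat.sub_le _ _, G, hG⟩

end GHProof

/-- Derandomization with polynomial overhead: if the randomized garden-hose
complexity of the family `f_n` with error `ε(n) = 1/2 - n^(-c)` is polynomially
bounded, then the deterministic garden-hose complexity is polynomially bounded
as well. -/
theorem gh_derandomization (c : ℕ) (hc : 1 ≤ c)
    (f : ∀ n : ℕ, (Fin n → Bool) → (Fin n → Bool) → Bool)
    (p : Polynomial ℕ)
    (hp : ∀ n : ℕ, GHr ((1 : ℝ) / 2 - (n : ℝ) ^ (-(c : ℤ))) (f n) ≤ p.eval n) :
    ∃ q : Polynomial ℕ, ∀ n : ℕ,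
      (∃ s : ℕ, s ≤ q.eval n ∧ ∃ G : GHGame n s, G.Computes (f n)) ∧
      GH (f n) ≤ q.eval n := by
  obtain ⟨s0, G0, hG0⟩ := GHProof.exists_game (f 0)
  obtain ⟨s1, G1, hG1⟩ := GHProof.exists_game (f 1)
  let q : Polynomial ℕ := ((2 * Polynomial.X + 1) * Polynomial.X ^ (2*c) + 1) *
    ((2 * Polynomial.X + 1) * Polynomial.X ^ (2*c) + 1) * (2 * (p + 1)) +
    (Polynomial.C s0 + Polynomial.C s1)
  have hq : ∀ n : ℕ, q.eval n = ((2*n+1)*n^(2*c)+1)*((2*n+1)*n^(2*c)+1)*(2*(p.eval n+1)) + (s0 + s1) := by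
    intro n; simp [q]
  have key : ∀ n : ℕ, ∃ s : ℕ, s ≤ q.eval n ∧ ∃ G : GHGame n s, G.Computes (f n) := by
    intro n
    rw [hq]
    match n with
    | 0 => exact ⟨s0, by omega, G0, hG0⟩
    | 1 => exact ⟨s1, by omega, G1, hG1⟩
    | n+2 =>
      obtain ⟨s, hs, hG⟩ := GHProof.main_n c (n+2) hc (by omega) (f (n+2))
      refine ⟨s, hs.trans ?_, hG⟩
      refine le_trans ?_ (Nat.le_add_right _ _)
      have := hp (n+2)
      gcongr
  refine ⟨q, fun n => ⟨key n, ?_⟩⟩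
  obtain ⟨s, hs, hG⟩ := key n
  exact le_trans (Nat.sInf_le hG) hs
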